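/- Let n, h, H be as in the grid-interpolation setup. Let τ ∈ [0,1] be a grid point (τ = i/n for some integer 0 ≤ i ≤ n) and let θ ∈ [τ,1]. Then H(τ,θ) ≥ (1−z(θ))·H(τ,θ̄) + z(θ)·H(τ,θ̂) − 1/n². -/

import Mathlib

/-- Lower grid point: `x̄ = ⌊nx⌋/n` for `x ∈ [0,1)`, and `1̄ = 1`. -/
noncomputable def gbar (n : ℕ) (x : ℝ) : ℝ :=
  if x = 1 then 1 else (⌊(n : ℝ) * x⌋ : ℝ) / n

/-- Upper grid point: `x̂ = x̄ + 1/n` for `x ∈ [0,1)`, and `1̂ = 1`. -/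
noncomputable def ghat (n : ℕ) (x : ℝ) : ℝ :=
  if x = 1 then 1 else (⌊(n : ℝ) * x⌋ : ℝ) / n + 1 / n

/-- Interpolation weight: `z(x) = n·(x − x̄)` for `x ∈ [0,1)`, and `z(1) = 0`. -/
noncomputable def gz (n : ℕ) (x : ℝ) : ℝ :=
  if x = 1 then 0 else (n : ℝ) * (x - (⌊(n : ℝ) * x⌋ : ℝ) / n)

/-- `H(τ,θ) = θ·h(τ,θ) − ∫_τ^θ h(τ,y) dy` (signed integral). -/
noncomputable def gridH (h : ℝ → ℝ → ℝ) (τ θ : ℝ) : ℝ :=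
  θ * h τ θ - ∫ y in τ..θ, h τ y

/-- Bilinear interpolation of a two-variable function at the grid corners. -/
noncomputable def interp2 (n : ℕ) (F : ℝ → ℝ → ℝ) (τ θ : ℝ) : ℝ :=
  (1 - gz n τ) * (1 - gz n θ) * F (gbar n τ) (gbar n θ)
  + (1 - gz n τ) * gz n θ * F (gbar n τ) (ghat n θ)
  + gz n τ * (1 - gz n θ) * F (ghat n τ) (gbar n θ)
  + gz n τ * gz n θ * F (ghat n τ) (ghat n θ)

theorem gz_grid (n i : ℕ) (hn : 0 < n) : gz n ((i:ℝ)/n) = 0 := by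
  have hn' : (n:ℝ) ≠ 0 := by positivity
  unfold gz
  split_ifs
  · rfl
  · rw [mul_div_cancel₀ _ hn', Int.floor_natCast]
    simp

theorem gbar_grid (n i : ℕ) (hn : 0 < n) : gbar n ((i:ℝ)/n) = (i:ℝ)/n := by
  have hn' : (n:ℝ) ≠ 0 := by positivity
  unfold gbar
  split_ifs with h1
  · exact h1.symm
  · rw [mul_div_cancel₀ _ hn', Int.floor_natCast]
    simp

theorem floor_eq_of_mem_Ico {n j : ℕ} (hn : 0 < n) {y : ℝ}
    (hy : y ∈ Set.Ico ((j:ℝ)/n) (((j:ℝ)+1)/n)) : ⌊(n:ℝ) * y⌋ = (j:ℤ) := by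
  have hn' : (0:ℝ) < n := by positivity
  rw [Int.floor_eq_iff]
  have h1 := (div_le_iff₀ hn').1 hy.1
  have h2 := (lt_div_iff₀ hn').1 hy.2
  constructor <;> push_cast <;> linarith

/-- The integral of an affine function from its base point. -/
theorem integral_affine_of_eqOn {g : ℝ → ℝ} {a t A s : ℝ} (hat : a ≤ t)
    (hg : ∀ y ∈ Set.Icc a t, g y = A + s * (y - a)) :
    ∫ y in a..t, g y = A * (t - a) + s * (t - a) ^ 2 / 2 := by
  have hcongr : ∫ y in a..t, g y = ∫ y in a..t, (A + s * (y - a)) := by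
    apply intervalIntegral.integral_congr
    intro y hy
    rw [Set.uIcc_of_le hat] at hy
    exact hg y hy
  have hderiv : ∀ y ∈ Set.uIcc a t,
      HasDerivAt (fun y => A * (y - a) + s * (y - a) ^ 2 / 2) (A + s * (y - a)) y := by
    intro y _
    have hy : HasDerivAt (fun y : ℝ => y - a) 1 y := (hasDerivAt_id y).sub_const a
    refine ((hy.const_mul A).add (((hy.pow 2).const_mul s).div_const 2)).congr_deriv ?_
    norm_num
    ring
  rw [hcongr, intervalIntegral.integral_eq_sub_of_hasDerivAt hderiv
    (Continuous.intervalIntegrable (by fun_prop) _ _)]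
  ring

/-- The exact interpolation error of `H(τ,·)` on an interval `[a, a + d]` where `h(τ,·)` is
affine. -/
theorem gridH_interp_error {h : ℝ → ℝ → ℝ} {τ a d z s : ℝ} (hd : 0 ≤ d)
    (hz : z ∈ Set.Icc (0:ℝ) 1) (hτa : IntervalIntegrable (h τ) MeasureTheory.volume τ a)
    (hcell : IntervalIntegrable (h τ) MeasureTheory.volume a (a + d))
    (hg : ∀ y ∈ Set.Icc a (a + d), h τ y = h τ a + s * (y - a)) :
    (1 - z) * gridH h τ a + z * gridH h τ (a + d) - gridH h τ (a + z * d)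
      = s / 2 * d ^ 2 * (z * (1 - z)) := by
  have hzd : 0 ≤ z * d := mul_nonneg hz.1 hd
  have hzd' : z * d ≤ d := mul_le_of_le_one_left hd hz.2
  have hmem : a + z * d ∈ Set.Icc a (a + d) := ⟨by linarith, by linarith⟩
  have hsub : IntervalIntegrable (h τ) MeasureTheory.volume a (a + z * d) := by
    apply hcell.mono_set
    rw [Set.uIcc_of_le (by linarith), Set.uIcc_of_le (by linarith)]
    exact Set.Icc_subset_Icc_right hmem.2
  have hI₁ := integral_affine_of_eqOn (g := h τ) (by linarith : a ≤ a + d) hg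
  have hI₂ := integral_affine_of_eqOn (g := h τ) hmem.1
    (fun y hy => hg y ⟨hy.1, hy.2.trans hmem.2⟩)
  unfold gridH
  rw [← intervalIntegral.integral_add_adjacent_intervals hτa hcell,
    ← intervalIntegral.integral_add_adjacent_intervals hτa hsub, hI₁, hI₂,
    hg _ hmem, hg (a + d) ⟨by linarith, le_rfl⟩]
  ring

/-- **Interpolation bound in the second coordinate.**
For `h` equal to the bilinear interpolation of its grid values, nondecreasing in each
coordinate and step-Lipschitz at grid points, if `τ` is a grid point and `θ ∈ [τ,1]`,
then `H(τ,θ) ≥ (1−z(θ))·H(τ,θ̄) + z(θ)·H(τ,θ̂) − 1/n²`. -/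
theorem gridH_interp_second
    (n : ℕ) (hn : 0 < n) (h : ℝ → ℝ → ℝ)
    (hinterp : ∀ τ ∈ Set.Icc (0:ℝ) 1, ∀ θ ∈ Set.Icc (0:ℝ) 1,
      h τ θ = (1 - gz n τ) * (1 - gz n θ) * h (gbar n τ) (gbar n θ)
        + (1 - gz n τ) * gz n θ * h (gbar n τ) (ghat n θ)
        + gz n τ * (1 - gz n θ) * h (ghat n τ) (gbar n θ)
        + gz n τ * gz n θ * h (ghat n τ) (ghat n θ))
    (hmono_left : ∀ θ ∈ Set.Icc (0:ℝ) 1, MonotoneOn (fun τ => h τ θ) (Set.Icc 0 1))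
    (hmono_right : ∀ τ ∈ Set.Icc (0:ℝ) 1, MonotoneOn (fun θ => h τ θ) (Set.Icc 0 1))
    (hlip_right : ∀ i j : ℕ, i ≤ n → j + 1 ≤ n →
      h ((i:ℝ)/n) (((j:ℝ)+1)/n) ≤ h ((i:ℝ)/n) ((j:ℝ)/n) + 4 / n)
    (hlip_left : ∀ i j : ℕ, i + 1 ≤ n → j ≤ n →
      h (((i:ℝ)+1)/n) ((j:ℝ)/n) ≤ h ((i:ℝ)/n) ((j:ℝ)/n) + 4 / n)
    (τ θ : ℝ)
    (hτgrid : ∃ i : ℕ, i ≤ n ∧ τ = (i:ℝ)/n)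
    (hθ : θ ∈ Set.Icc τ 1) :
    (1 - gz n θ) * gridH h τ (gbar n θ) + gz n θ * gridH h τ (ghat n θ) - 1 / (n:ℝ)^2
      ≤ gridH h τ θ := by
  have hn' : (0:ℝ) < n := by positivity
  obtain ⟨i, hi, rfl⟩ := hτgrid
  set τ : ℝ := (i:ℝ)/n with hτ
  have hτ0 : 0 ≤ τ := by positivity
  have hτmem : τ ∈ Set.Icc (0:ℝ) 1 := ⟨hτ0, hθ.1.trans hθ.2⟩
  by_cases hθ1 : θ = 1
  · have hpos : 0 ≤ 1 / (n:ℝ)^2 := by positivity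
    simp only [gz, gbar, ghat, hθ1, if_true]
    linarith
  have hθlt : θ < 1 := lt_of_le_of_ne hθ.2 hθ1
  have hθ0 : 0 ≤ θ := hτ0.trans hθ.1
  obtain ⟨j, hj⟩ := Int.eq_ofNat_of_zero_le (Int.floor_nonneg.2 (mul_nonneg hn'.le hθ0))
  have hjle : (j:ℝ) ≤ n * θ := by exact_mod_cast hj ▸ Int.floor_le ((n:ℝ) * θ)
  have hjlt : (n:ℝ) * θ < j + 1 := by exact_mod_cast hj ▸ Int.lt_floor_add_one ((n:ℝ) * θ)
  have hjn : j + 1 ≤ n := by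
    have : (j:ℝ) < n := by nlinarith
    exact_mod_cast this
  have hjn' : (j:ℝ) + 1 ≤ n := by exact_mod_cast hjn
  have hbeq : ((j:ℝ)+1)/n = (j:ℝ)/n + 1/n := add_div _ _ _
  have hb1 : (j:ℝ)/n + 1/n ≤ 1 := by
    rw [← hbeq]
    exact (div_le_one hn').2 hjn'
  have hd : 0 < 1/(n:ℝ) := by positivity
  have ha0 : 0 ≤ (j:ℝ)/n := by positivity
  have hint : ∀ u ∈ Set.Icc (0:ℝ) 1, ∀ v ∈ Set.Icc (0:ℝ) 1,
      IntervalIntegrable (h τ) MeasureTheory.volume u v := fun u hu v hv =>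
    MonotoneOn.intervalIntegrable ((hmono_right τ hτmem).mono (Set.uIcc_subset_Icc hu hv))
  have hamem : (j:ℝ)/n ∈ Set.Icc (0:ℝ) 1 := ⟨ha0, by linarith⟩
  have hbmem : (j:ℝ)/n + 1/n ∈ Set.Icc (0:ℝ) 1 := ⟨by linarith, hb1⟩
  set s : ℝ := n * (h τ ((j:ℝ)/n + 1/n) - h τ ((j:ℝ)/n)) with hs
  have haffine : ∀ y ∈ Set.Icc ((j:ℝ)/n) ((j:ℝ)/n + 1/n),
      h τ y = h τ ((j:ℝ)/n) + s * (y - (j:ℝ)/n) := by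
    intro y hy
    rcases hy.2.eq_or_lt with rfl | hlt
    · rw [hs]
      field_simp
      ring
    · have hfloor := floor_eq_of_mem_Ico hn (y := y) ⟨hy.1, hbeq ▸ hlt⟩
      have hy1 : y ≠ 1 := by linarith
      have hval := hinterp τ hτmem y ⟨ha0.trans hy.1, by linarith⟩
      rw [hτ, gz_grid n i hn, gbar_grid n i hn, ← hτ] at hval
      simp only [gz, gbar, ghat, hy1, if_false, hfloor, Int.cast_natCast] at hval
      rw [hval, hs]
      ring
  have hs4 : s ≤ 4 := by
    have hstep := hlip_right i j hi hjn
    rw [hbeq, ← hτ] at hstep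
    calc s ≤ n * (4 / n) := mul_le_mul_of_nonneg_left (by linarith) hn'.le
      _ = 4 := by field_simp
  have hz : gz n θ = n * θ - j := by
    simp only [gz, hθ1, if_false, hj]
    push_cast
    field_simp
  have hzmem : gz n θ ∈ Set.Icc (0:ℝ) 1 := ⟨by linarith, by linarith⟩
  have herr := gridH_interp_error hd.le hzmem (hint τ hτmem _ hamem) (hint _ hamem _ hbmem) haffine
  have hθeq : (j:ℝ)/n + gz n θ * (1/n) = θ := by
    rw [hz]
    field_simp
    ring
  have hbar : gbar n θ = (j:ℝ)/n := by
    simp [gbar, hθ1, hj]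
  have hhat : ghat n θ = (j:ℝ)/n + 1/n := by
    simp [ghat, hθ1, hj]
  rw [hθeq] at herr
  rw [hbar, hhat]
  have hw0 : 0 ≤ gz n θ * (1 - gz n θ) := mul_nonneg hzmem.1 (by linarith [hzmem.2])
  have hw : gz n θ * (1 - gz n θ) ≤ 1/4 := by nlinarith [sq_nonneg (gz n θ - 1/2)]
  have hbound : s / 2 * (1/(n:ℝ))^2 * (gz n θ * (1 - gz n θ)) ≤ 1/(n:ℝ)^2 := by
    calc s / 2 * (1/(n:ℝ))^2 * (gz n θ * (1 - gz n θ))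
        ≤ 2 * (1/(n:ℝ))^2 * (gz n θ * (1 - gz n θ)) := by
          gcongr
          linarith
      _ ≤ 2 * (1/(n:ℝ))^2 * (1/4) := by gcongr
      _ ≤ 1/(n:ℝ)^2 := by
          rw [one_div_pow]
          linarith [show 0 ≤ 1/(n:ℝ)^2 by positivity]
  linarith
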